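/- arXiv:2005.00455 — 2 statements merged into one kernel-verified Lean document; each statement's English description precedes it below -/
import Mathlib

section
/- Let X be a measurable space equipped with a symmetric adjacency relation Adj, and let f : X → ℝ be a function whose sensitivity is bounded by Δ > 0, i.e. |f(x) − f(x′)| ≤ Δ for all adjacent pairs x, x′. Fix 0 < ε < 1 and 0 < δ < 1, and suppose σ ≥ Δ·√(2·ln(1.25/δ))/ε. Then the Gaussian mechanism M that on input x outputs a sample from the Gaussian distribution N(f(x), σ²) is (ε, δ)-differentially private: for every pair of adjacent inputs x, x′ and every measurable set S ⊆ ℝ, M(x)(S) ≤ exp(ε)·M(x′)(S) + δ. -/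
open MeasureTheory ProbabilityTheory Real

/-- `(ε, δ)`-differential privacy of a randomized mechanism `M` with respect to an
adjacency relation `Adj`. -/
def IsDP {X Y : Type*} [MeasurableSpace Y] (Adj : X → X → Prop)
    (M : X → Measure Y) (ε δ : ℝ) : Prop :=
  ∀ x x', Adj x x' → ∀ S : Set Y, MeasurableSet S →
    M x S ≤ ENNReal.ofReal (Real.exp ε) * M x' S + ENNReal.ofReal δ

open scoped NNReal ENNReal

/-- `1 - e⁻ᵘ ≤ e^(lu) / (1 + l)` for every rate `l ≥ 0`, with denominators cleared. -/
theorem one_add_le_exp_mul_add {l : ℝ} (hl : 0 ≤ l) (u : ℝ) :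
    1 + l ≤ exp (l * u) + (1 + l) * exp (-u) := by
  have h₁ := add_one_le_exp (l * u)
  have h₂ := add_one_le_exp (-u)
  rcases le_total u 1 with hu | hu
  · nlinarith
  · nlinarith [mul_nonneg (add_nonneg zero_le_one hl) (exp_pos (-u)).le]

/-- A Gaussian density is at most `e^ε` times a translated one, up to a multiple of a third
Gaussian density whose mean is extrapolated from the first two. -/
theorem gaussianPDFReal_le_add (m m' ε : ℝ) {v : ℝ≥0} (hv : v ≠ 0) {l : ℝ} (hl : 0 ≤ l) (x : ℝ) :
    gaussianPDFReal m v x ≤ exp ε * gaussianPDFReal m' v x +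
      exp (l * (1 + l) * (m - m') ^ 2 / (2 * v) - l * ε) / (1 + l) *
        gaussianPDFReal (m + l * (m - m')) v x := by
  have hv' : (v : ℝ) ≠ 0 := by exact_mod_cast hv
  have hl' : 0 < 1 + l := by linarith
  set u : ℝ := ((x - m') ^ 2 - (x - m) ^ 2) / (2 * v) - ε with hu
  set p : ℝ := gaussianPDFReal m v x with hp
  have hp0 : 0 ≤ p := gaussianPDFReal_nonneg m v x
  have h₁ : exp ε * gaussianPDFReal m' v x = p * exp (-u) := by
    simp only [hp, gaussianPDFReal]
    rw [mul_left_comm, mul_assoc _ (exp _) (exp _), ← exp_add, ← exp_add]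
    congr 2
    rw [hu]
    field_simp
    ring
  have h₂ : exp (l * (1 + l) * (m - m') ^ 2 / (2 * v) - l * ε) *
      gaussianPDFReal (m + l * (m - m')) v x = p * exp (l * u) := by
    simp only [hp, gaussianPDFReal]
    rw [mul_left_comm, mul_assoc _ (exp _) (exp _), ← exp_add, ← exp_add]
    congr 2
    rw [hu]
    field_simp
    ring
  rw [h₁, div_mul_eq_mul_div, h₂, ← sub_le_iff_le_add', le_div_iff₀ hl']
  nlinarith [mul_le_mul_of_nonneg_left (one_add_le_exp_mul_add hl u) hp0]

theorem gaussianReal_le_add (m m' ε : ℝ) {v : ℝ≥0} (hv : v ≠ 0) {l : ℝ} (hl : 0 ≤ l)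
    (S : Set ℝ) :
    gaussianReal m v S ≤ ENNReal.ofReal (exp ε) * gaussianReal m' v S +
      ENNReal.ofReal (exp (l * (1 + l) * (m - m') ^ 2 / (2 * v) - l * ε) / (1 + l)) := by
  set K := exp (l * (1 + l) * (m - m') ^ 2 / (2 * v) - l * ε) / (1 + l)
  have hK : 0 ≤ K := by positivity
  calc gaussianReal m v S
      = ∫⁻ x in S, gaussianPDF m v x := gaussianReal_apply m hv S
    _ ≤ ∫⁻ x in S, (ENNReal.ofReal (exp ε) * gaussianPDF m' v x +
          ENNReal.ofReal K * gaussianPDF (m + l * (m - m')) v x) := by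
        refine lintegral_mono fun x => ?_
        simp only [gaussianPDF]
        rw [← ENNReal.ofReal_mul (exp_pos ε).le, ← ENNReal.ofReal_mul hK,
          ← ENNReal.ofReal_add (mul_nonneg (exp_pos ε).le (gaussianPDFReal_nonneg _ _ _))
            (mul_nonneg hK (gaussianPDFReal_nonneg _ _ _))]
        exact ENNReal.ofReal_le_ofReal (gaussianPDFReal_le_add m m' ε hv hl x)
    _ = ENNReal.ofReal (exp ε) * gaussianReal m' v S +
          ENNReal.ofReal K * gaussianReal (m + l * (m - m')) v S := by
        rw [lintegral_add_left ((measurable_gaussianPDF m' v).const_mul _),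
          lintegral_const_mul _ (measurable_gaussianPDF _ v),
          lintegral_const_mul _ (measurable_gaussianPDF _ v),
          gaussianReal_apply m' hv, gaussianReal_apply _ hv]
    _ ≤ ENNReal.ofReal (exp ε) * gaussianReal m' v S + ENNReal.ofReal K := by
        gcongr
        exact mul_le_of_le_one_right' prob_le_one

/-- The Gaussian mechanism `x ↦ N(f x, σ²)` for a real-valued function `f` of
sensitivity at most `Δ`, with `σ ≥ Δ·√(2·ln(1.25/δ))/ε` and `0 < ε < 1`, is
`(ε, δ)`-differentially private. -/
theorem gaussian_mechanism_is_dp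
    {X : Type*} [MeasurableSpace X] (Adj : X → X → Prop) (hAdj : Symmetric Adj)
    (f : X → ℝ) (Δ ε δ σ : ℝ) (hΔ : 0 < Δ)
    (hsens : ∀ x x', Adj x x' → |f x - f x'| ≤ Δ)
    (hε0 : 0 < ε) (hε1 : ε < 1) (hδ0 : 0 < δ) (hδ1 : δ < 1)
    (hσ : σ ≥ Δ * Real.sqrt (2 * Real.log (1.25 / δ)) / ε) :
    IsDP Adj (fun x => gaussianReal (f x) (σ ^ 2).toNNReal) ε δ := by
  intro x x' hx S _
  set a : ℝ := log (1.25 / δ) with ha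
  have ha0 : 1 / 5 ≤ a := by
    have h₁ : (1.25 : ℝ) ≤ 1.25 / δ := by
      rw [le_div_iff₀ hδ0]; linarith
    have h₂ := one_sub_inv_le_log_of_pos (show (0 : ℝ) < 1.25 by norm_num)
    have h₃ := log_le_log (by norm_num) h₁
    norm_num at h₂ h₃ ⊢
    linarith
  have hδ : δ = 1.25 * exp (-a) := by
    rw [exp_neg, ha, exp_log (by positivity)]
    field_simp
  have hsqrt : 0 < √(2 * a) := sqrt_pos.mpr (by linarith)
  have hσ0 : 0 < σ := lt_of_lt_of_le (by positivity) hσ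
  have hv : (σ ^ 2).toNNReal ≠ 0 := by simpa using hσ0.ne'
  have hvar : 2 * a * (f x - f x') ^ 2 ≤ ε ^ 2 * σ ^ 2 := by
    have h₁ : Δ * √(2 * a) ≤ σ * ε := (div_le_iff₀ hε0).mp hσ
    have h₂ : |f x - f x'| * √(2 * a) ≤ σ * ε :=
      (mul_le_mul_of_nonneg_right (hsens x x' hx) hsqrt.le).trans h₁
    have h₃ := pow_le_pow_left₀ (by positivity) h₂ 2
    rw [mul_pow, sq_abs, sq_sqrt (by linarith)] at h₃
    linarith
  have hl : 0 ≤ 2 * a / ε := by positivity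
  refine (gaussianReal_le_add (f x) (f x') ε hv hl S).trans ?_
  gcongr
  rw [coe_toNNReal _ (sq_nonneg σ)]
  have hexp : 2 * a / ε * (1 + 2 * a / ε) * (f x - f x') ^ 2 / (2 * σ ^ 2) - 2 * a / ε * ε
      ≤ 1 / 2 + -a := by
    have h₁ : 2 * a / ε * (1 + 2 * a / ε) * (f x - f x') ^ 2 / (2 * σ ^ 2)
        ≤ (ε + 2 * a) / 2 := by
      rw [div_le_iff₀ (by positivity)]
      calc 2 * a / ε * (1 + 2 * a / ε) * (f x - f x') ^ 2
          = (ε + 2 * a) / ε ^ 2 * (2 * a * (f x - f x') ^ 2) := by field_simp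
        _ ≤ (ε + 2 * a) / ε ^ 2 * (ε ^ 2 * σ ^ 2) := by gcongr
        _ = (ε + 2 * a) / 2 * (2 * σ ^ 2) := by field_simp
    rw [div_mul_cancel₀ _ hε0.ne']
    linarith
  have hhalf : exp (1 / 2) ≤ 1.75 := by
    have h₁ : exp (1 / 2) ^ 2 = exp 1 := by rw [← exp_nat_mul]; norm_num
    nlinarith [exp_one_lt_d9, exp_pos (1 / 2 : ℝ)]
  have hl' : 2 / 5 ≤ 2 * a / ε := by
    rw [le_div_iff₀ hε0]; linarith
  rw [div_le_iff₀ (by positivity), hδ]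
  calc _ ≤ exp (1 / 2 + -a) := exp_le_exp.mpr hexp
    _ = exp (1 / 2) * exp (-a) := exp_add _ _
    _ ≤ (1.25 * (1 + 2 * a / ε)) * exp (-a) := by
        gcongr
        linarith
    _ = 1.25 * exp (-a) * (1 + 2 * a / ε) := by ring
end

section
/- Fix Δ > 0, 0 < ε < 1, 0 < δ < 1, and suppose σ ≥ Δ·√(2·ln(1.25/δ))/ε. If x is a random variable distributed as N(0, σ²), then the probability that the absolute privacy loss of the shifted Gaussian exceeds ε is at most δ; concretely, P( |2·x·Δ + Δ²| / (2σ²) ≥ ε ) ≤ δ, where the quantity |2xΔ + Δ²|/(2σ²) equals the absolute log-ratio of the densities of N(0, σ²) and N(Δ, σ²) evaluated via the noise x. -/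
open MeasureTheory ProbabilityTheory Real

theorem gaussianReal_real_Iic_neg (x : ℝ) :
    (gaussianReal 0 1).real (Set.Iic (-x)) = (gaussianReal 0 1).real (Set.Ici x) := by
  have h := gaussianReal_map_neg (μ := 0) (v := 1)
  rw [neg_zero] at h
  conv_lhs => rw [← h]
  rw [map_measureReal_apply measurable_neg measurableSet_Iic]
  congr 1
  ext y
  simp

theorem gaussianReal_real_Ici_zero : (gaussianReal 0 1).real (Set.Ici 0) = 1 / 2 := by
  have := nullSingletonClass_gaussianReal (μ := 0) (v := 1) one_ne_zero
  have h1 := gaussianReal_real_Iic_neg 0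
  rw [neg_zero] at h1
  have h2 := probReal_compl_eq_one_sub (μ := gaussianReal 0 1) (measurableSet_Iic (a := (0 : ℝ)))
  have h3 : (gaussianReal 0 1).real (Set.Ioi 0) = (gaussianReal 0 1).real (Set.Ici 0) :=
    measureReal_congr Ioi_ae_eq_Ici
  rw [Set.compl_Iic] at h2
  linarith

theorem gaussianReal_real_eq_setIntegral (μ : ℝ) (s : Set ℝ) :
    (gaussianReal μ 1).real s = ∫ x in s, gaussianPDFReal μ 1 x := by
  rw [measureReal_def, gaussianReal_apply_eq_integral μ one_ne_zero s, ENNReal.toReal_ofReal]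
  exact integral_nonneg fun x => gaussianPDFReal_nonneg μ 1 x

/-- The Chernoff bound for the standard Gaussian, with the sharp constant `1 / 2`. -/
theorem gaussianReal_real_Ici_le {x : ℝ} (hx : 0 ≤ x) :
    (gaussianReal 0 1).real (Set.Ici x) ≤ exp (-(x ^ 2 / 2)) / 2 := by
  have hshift : (gaussianReal 0 1).real (Set.Ici x) = (gaussianReal (-x) 1).real (Set.Ici 0) := by
    have h := gaussianReal_map_add_const (μ := 0) (v := 1) (-x)
    rw [zero_add] at h
    rw [← h, map_measureReal_apply (by fun_prop) measurableSet_Ici]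
    congr 1
    ext y
    simp
  rw [hshift, gaussianReal_real_eq_setIntegral]
  calc ∫ u in Set.Ici 0, gaussianPDFReal (-x) 1 u
      ≤ ∫ u in Set.Ici 0, exp (-(x ^ 2 / 2)) * gaussianPDFReal 0 1 u := by
        refine setIntegral_mono_on (integrable_gaussianPDFReal _ _).integrableOn
          ((integrable_gaussianPDFReal _ _).const_mul _).integrableOn measurableSet_Ici ?_
        intro u hu
        have hu : 0 ≤ u := hu
        simp only [gaussianPDFReal, NNReal.coe_one, mul_one, sub_zero, sub_neg_eq_add]
        rw [mul_left_comm, ← exp_add]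
        gcongr
        nlinarith [mul_nonneg hx hu]
    _ = exp (-(x ^ 2 / 2)) / 2 := by
        rw [integral_const_mul, ← gaussianReal_real_eq_setIntegral, gaussianReal_real_Ici_zero]
        ring

theorem gaussianPDFReal_zero_one_le (u : ℝ) : gaussianPDFReal 0 1 u ≤ 1 / 2 := by
  simp only [gaussianPDFReal, NNReal.coe_one, mul_one, sub_zero]
  have h1 : (√(2 * π))⁻¹ ≤ 1 / 2 := by
    rw [one_div]
    gcongr
    refine le_sqrt_of_sq_le ?_
    linarith [pi_gt_three]
  have h2 : exp (-u ^ 2 / 2) ≤ 1 := by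
    rw [exp_le_one_iff]
    nlinarith [sq_nonneg u]
  nlinarith [exp_pos (-u ^ 2 / 2)]

theorem gaussianReal_real_Ici_neg_le {y : ℝ} (hy : 0 ≤ y) :
    (gaussianReal 0 1).real (Set.Ici (-y)) ≤ 1 / 2 + y / 2 := by
  have h1 : (gaussianReal 0 1).real (Set.Icc (-y) 0) ≤ y / 2 := by
    rw [gaussianReal_real_eq_setIntegral]
    calc ∫ u in Set.Icc (-y) 0, gaussianPDFReal 0 1 u
        ≤ ∫ _ in Set.Icc (-y) 0, (1 / 2 : ℝ) :=
          setIntegral_mono (integrable_gaussianPDFReal _ _).integrableOn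
            (by simp) gaussianPDFReal_zero_one_le
      _ = y / 2 := by
          simp [hy]
          ring
  have h2 : Set.Ici (-y) ⊆ Set.Ici 0 ∪ Set.Icc (-y) 0 := by
    intro u hu
    rcases le_total 0 u with h | h
    · exact Or.inl h
    · exact Or.inr ⟨hu, h⟩
  have h3 := (measureReal_mono (μ := gaussianReal 0 1) h2).trans (measureReal_union_le _ _)
  rw [gaussianReal_real_Ici_zero] at h3
  linarith

theorem gaussianReal_real_tails_le {c s : ℝ} (hc : 0 < c) (hc2 : 2 / 5 ≤ c ^ 2) (hs : 0 < s)
    (hcs : c * s ≤ 1 / 2) :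
    (gaussianReal 0 1).real (Set.Ici (c - s)) + (gaussianReal 0 1).real (Set.Ici (c + s)) ≤
      5 / 4 * exp (-(c ^ 2 / 2)) := by
  have hplus := gaussianReal_real_Ici_le (add_pos hc hs).le
  rcases le_total s c with h | h
  · have hminus := gaussianReal_real_Ici_le (sub_nonneg.2 h)
    have hcosh : exp (c * s) + exp (-(c * s)) ≤ 5 / 2 := by
      have h1 : cosh (c * s) ≤ exp ((c * s) ^ 2 / 2) := cosh_le_exp_half_sq _
      have h2 : exp ((c * s) ^ 2 / 2) ≤ exp (1 / 8) := by
        rw [exp_le_exp]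
        nlinarith [mul_pos hc hs]
      have h3 : exp (1 / 8 : ℝ) ≤ 5 / 4 := by
        have h4 := add_one_le_exp (-(1 / 8) : ℝ)
        have h5 : exp (1 / 8 : ℝ) * exp (-(1 / 8)) = 1 := by rw [← exp_add]; simp
        nlinarith [exp_pos (1 / 8 : ℝ)]
      rw [cosh_eq] at h1
      linarith
    have e1 : exp (-((c - s) ^ 2 / 2)) ≤ exp (-(c ^ 2 / 2)) * exp (c * s) := by
      rw [← exp_add]
      gcongr
      nlinarith [sq_nonneg s]
    have e2 : exp (-((c + s) ^ 2 / 2)) ≤ exp (-(c ^ 2 / 2)) * exp (-(c * s)) := by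
      rw [← exp_add]
      gcongr
      nlinarith [sq_nonneg s]
    nlinarith [exp_pos (-(c ^ 2 / 2))]
  · have hminus := gaussianReal_real_Ici_neg_le (sub_nonneg.2 h)
    rw [neg_sub] at hminus
    have hc_lower : 63 / 100 ≤ c := by nlinarith
    have hs_upper : s ≤ 4 / 5 := by nlinarith
    have htail : exp (-((c + s) ^ 2 / 2)) ≤ 5 / 8 := by
      have h1 := add_one_le_exp ((c + s) ^ 2 / 2)
      have h2 : exp ((c + s) ^ 2 / 2) * exp (-((c + s) ^ 2 / 2)) = 1 := by rw [← exp_add]; simp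
      have h3 : 8 / 5 ≤ exp ((c + s) ^ 2 / 2) := by nlinarith
      nlinarith [exp_pos (-((c + s) ^ 2 / 2))]
    have hexp : 3 / 4 ≤ exp (-(c ^ 2 / 2)) := by
      have h1 := add_one_le_exp (-(c ^ 2 / 2))
      nlinarith
    linarith

/-- Tail bound on the privacy loss random variable of the Gaussian mechanism: if
`x ~ N(0, σ²)` with `σ ≥ Δ·√(2·ln(1.25/δ))/ε`, `0 < ε < 1` and `0 < δ < 1`, then the
probability that the absolute privacy loss `|2xΔ + Δ²|/(2σ²)` is at least `ε` is at
most `δ`. -/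
theorem gaussian_privacy_loss_tail_bound
    (Δ ε δ σ : ℝ) (hΔ : 0 < Δ)
    (hε0 : 0 < ε) (hε1 : ε < 1) (hδ0 : 0 < δ) (hδ1 : δ < 1)
    (hσ : σ ≥ Δ * Real.sqrt (2 * Real.log (1.25 / δ)) / ε) :
    gaussianReal 0 (σ ^ 2).toNNReal
      {x : ℝ | ε ≤ |2 * x * Δ + Δ ^ 2| / (2 * σ ^ 2)} ≤ ENNReal.ofReal δ := by
  set L := log (1.25 / δ) with hL
  have hL_lower : 1 / 5 ≤ L := by
    have h1 : log 1.25 ≤ L := by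
      rw [hL]
      gcongr
      rw [le_div_iff₀ hδ0]
      nlinarith
    have h2 := one_sub_inv_le_log_of_pos (x := 1.25) (by norm_num)
    norm_num at h1 h2
    linarith
  have hexpL : 5 / 4 * exp (-L) = δ := by
    rw [hL, exp_neg, exp_log (by positivity)]
    field_simp
    norm_num
  have hσ0 : 0 < σ := lt_of_lt_of_le (by positivity) hσ
  set c := ε * σ / Δ with hc
  have hc0 : 0 < c := by positivity
  have hsqrt : √(2 * L) ≤ c := by
    rw [hc, le_div_iff₀ hΔ]
    rw [ge_iff_le, div_le_iff₀ hε0] at hσ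
    linarith
  have hc2 : 2 * L ≤ c ^ 2 := (sqrt_le_left hc0.le).1 hsqrt
  set s := Δ / (2 * σ) with hs
  have hs0 : 0 < s := by positivity
  have hcs : c * s ≤ 1 / 2 := by
    have : c * s = ε / 2 := by
      rw [hc, hs]
      field_simp
    linarith
  have hmap : gaussianReal 0 (σ ^ 2).toNNReal = (gaussianReal 0 1).map (σ * ·) := by
    rw [gaussianReal_map_const_mul, mul_zero, mul_one, toNNReal_of_nonneg (sq_nonneg σ)]
  have hmeas : MeasurableSet {x : ℝ | ε ≤ |2 * x * Δ + Δ ^ 2| / (2 * σ ^ 2)} :=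
    measurableSet_le (by fun_prop) (by fun_prop)
  have hsub : (σ * ·) ⁻¹' {x : ℝ | ε ≤ |2 * x * Δ + Δ ^ 2| / (2 * σ ^ 2)} ⊆
      Set.Ici (c - s) ∪ Set.Iic (-(c + s)) := by
    intro t ht
    have ht : ε ≤ |2 * (σ * t) * Δ + Δ ^ 2| / (2 * σ ^ 2) := ht
    have hloss : |2 * (σ * t) * Δ + Δ ^ 2| / (2 * σ ^ 2) = Δ / σ * |t + s| := by
      have : 2 * (σ * t) * Δ + Δ ^ 2 = 2 * σ * Δ * (t + s) := by
        rw [hs]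
        field_simp
      rw [this, abs_mul, abs_of_pos (by positivity : 0 < 2 * σ * Δ)]
      field_simp
    have habs : c ≤ |t + s| := by
      rw [hloss, div_mul_eq_mul_div, le_div_iff₀ hσ0] at ht
      rw [hc, div_le_iff₀ hΔ]
      linarith
    rcases le_abs.1 habs with h | h
    · exact Or.inl (show c - s ≤ t by linarith)
    · exact Or.inr (show t ≤ -(c + s) by linarith)
  rw [hmap, Measure.map_apply (by fun_prop) hmeas]
  refine (measure_mono hsub).trans ?_
  rw [← ofReal_measureReal]
  refine ENNReal.ofReal_le_ofReal ?_
  calc (gaussianReal 0 1).real (Set.Ici (c - s) ∪ Set.Iic (-(c + s)))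
      ≤ (gaussianReal 0 1).real (Set.Ici (c - s)) + (gaussianReal 0 1).real (Set.Ici (c + s)) := by
        rw [← gaussianReal_real_Iic_neg (c + s)]
        exact measureReal_union_le _ _
    _ ≤ 5 / 4 * exp (-(c ^ 2 / 2)) :=
        gaussianReal_real_tails_le hc0 (by linarith) hs0 hcs
    _ ≤ 5 / 4 * exp (-L) := by
        gcongr
        linarith
    _ = δ := hexpL
end
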